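/- arXiv:1903.05006 — 2 statements merged into one kernel-verified Lean document; each statement's English description precedes it below -/
import Mathlib

section
/- Let A be a real m×n matrix, B a real s×n matrix, σ > 0, λ > 0, and ẑ ∈ ℝⁿ. Let Q̂ = diag(q̂) be the n×n diagonal matrix with q̂ᵢ = 1 if |ẑᵢ| > σλ and q̂ᵢ = 0 otherwise. If the constraint nondegeneracy condition holds at ẑ, i.e., the matrix B Q̂ has rank s, then for every (u, v) ∈ ℝ^m × ℝ^s with (u, v) ≠ (0, 0), one has ‖u‖² + σ·⟨Q̂(Aᵀu − Bᵀv), Aᵀu − Bᵀv⟩ > 0; that is, the block matrix [[I_m, 0],[0, 0]] + σ·[A; −B]·Q̂·[Aᵀ, −Bᵀ] is positive definite. -/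
open Matrix

/-- Euclidean norm on `Fin n → ℝ`. -/
noncomputable def euclNorm {n : ℕ} (x : Fin n → ℝ) : ℝ := Real.sqrt (∑ i, x i ^ 2)

/-- Euclidean inner product on `Fin n → ℝ`. -/
def dotp {n : ℕ} (x y : Fin n → ℝ) : ℝ := ∑ i, x i * y i

/-- ℓ₁ norm on `Fin n → ℝ`. -/
def l1norm {n : ℕ} (x : Fin n → ℝ) : ℝ := ∑ i, |x i|

/-- Euclidean distance from a point to a set: `inf_{y ∈ S} ‖x − y‖`. -/
noncomputable def distSet {n : ℕ} (x : Fin n → ℝ) (S : Set (Fin n → ℝ)) : ℝ :=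
  sInf ((fun y => euclNorm (x - y)) '' S)

/-- Subdifferential of a (convex) function `g` at `x`. -/
def subdiff {n : ℕ} (g : (Fin n → ℝ) → ℝ) (x : Fin n → ℝ) : Set (Fin n → ℝ) :=
  {s : Fin n → ℝ | ∀ y, g y ≥ g x + dotp s (y - x)}

/-- A matrix whose rank equals its number of rows has trivial left kernel. -/
theorem vecMul_injective_of_rank_eq {s n : ℕ} {M : Matrix (Fin s) (Fin n) ℝ}
    (h : M.rank = s) : Function.Injective M.vecMul := by
  rw [Matrix.vecMul_injective_iff, linearIndependent_iff_card_eq_finrank_span,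
    Set.finrank, ← Matrix.rank_eq_finrank_span_row, h, Fintype.card_fin]

theorem euclNorm_sq {n : ℕ} (x : Fin n → ℝ) : euclNorm x ^ 2 = x ⬝ᵥ x := by
  rw [euclNorm, Real.sq_sqrt (Finset.sum_nonneg fun i _ => sq_nonneg (x i))]
  simp [dotProduct, sq]

theorem dotp_eq_dotProduct {n : ℕ} (x y : Fin n → ℝ) : dotp x y = x ⬝ᵥ y := rfl

/-- If `Q` is a symmetric idempotent and `B * Q` has full row rank, the quadratic form
`‖u‖² + σ⟨Q(Aᵀu − Bᵀv), Aᵀu − Bᵀv⟩` is positive away from the origin. -/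
theorem quadratic_form_pos {m n s : ℕ} (A : Matrix (Fin m) (Fin n) ℝ)
    (B : Matrix (Fin s) (Fin n) ℝ) {Q : Matrix (Fin n) (Fin n) ℝ} (hQt : Qᵀ = Q)
    (hQQ : Q * Q = Q) (hrank : (B * Q).rank = s) {σ : ℝ} (hσ : 0 < σ)
    (u : Fin m → ℝ) (v : Fin s → ℝ) (huv : ¬(u = 0 ∧ v = 0)) :
    0 < euclNorm u ^ 2 + σ * dotp (Q *ᵥ (Aᵀ *ᵥ u - Bᵀ *ᵥ v)) (Aᵀ *ᵥ u - Bᵀ *ᵥ v) := by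
  have hform (w : Fin n → ℝ) : dotp (Q *ᵥ w) w = (Q *ᵥ w) ⬝ᵥ (Q *ᵥ w) := by
    rw [dotp_eq_dotProduct, Matrix.dotProduct_mulVec, Matrix.vecMul_mulVec, hQt, hQQ,
      ← Matrix.mulVec_transpose, hQt]
  rw [euclNorm_sq, hform]
  have hnonneg {k : ℕ} (x : Fin k → ℝ) : 0 ≤ x ⬝ᵥ x :=
    Finset.sum_nonneg fun i _ => mul_self_nonneg (x i)
  have hpos {k : ℕ} {x : Fin k → ℝ} (hx : x ≠ 0) : 0 < x ⬝ᵥ x :=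
    (hnonneg x).lt_of_ne fun h => hx (dotProduct_self_eq_zero.mp h.symm)
  by_cases hu : u = 0
  · subst hu
    have hv : v ≠ 0 := fun hv => huv ⟨rfl, hv⟩
    have hne : Q *ᵥ (Aᵀ *ᵥ 0 - Bᵀ *ᵥ v) ≠ 0 := by
      intro h
      refine hv (vecMul_injective_of_rank_eq hrank ?_)
      simpa [Matrix.mulVec_neg, ← Matrix.mulVec_transpose, Matrix.transpose_mul, hQt] using h
    simpa using mul_pos hσ (hpos hne)
  · exact add_pos_of_pos_of_nonneg (hpos hu) (mul_nonneg hσ.le (hnonneg _))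

/-- **Constraint nondegeneracy implies positive definiteness** (Proposition 6):
with `Q̂ = diag(q̂)`, `q̂ᵢ = 1` if `|ẑᵢ| > σλ` and `0` otherwise, if `B Q̂` has rank `s`
then `‖u‖² + σ⟨Q̂(Aᵀu − Bᵀv), Aᵀu − Bᵀv⟩ > 0` for all `(u,v) ≠ (0,0)`, i.e. the block
matrix `[[I,0],[0,0]] + σ[A;−B] Q̂ [Aᵀ,−Bᵀ]` is positive definite. -/
theorem constraint_nondegeneracy_posDef
    {m n s : ℕ} (A : Matrix (Fin m) (Fin n) ℝ) (B : Matrix (Fin s) (Fin n) ℝ)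
    (σ lam : ℝ) (hσ : 0 < σ) (hlam : 0 < lam)
    (zhat : Fin n → ℝ)
    (Qhat : Matrix (Fin n) (Fin n) ℝ)
    (hQhat : Qhat = Matrix.diagonal (fun i => if σ * lam < |zhat i| then (1 : ℝ) else 0))
    (hnondeg : (B * Qhat).rank = s) :
    (∀ (u : Fin m → ℝ) (v : Fin s → ℝ), ¬(u = 0 ∧ v = 0) →
      0 < euclNorm u ^ 2
        + σ * dotp (Qhat *ᵥ (Aᵀ *ᵥ u - Bᵀ *ᵥ v)) (Aᵀ *ᵥ u - Bᵀ *ᵥ v)) ∧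
    (Matrix.fromBlocks (1 : Matrix (Fin m) (Fin m) ℝ) 0 0
        (0 : Matrix (Fin s) (Fin s) ℝ)
      + σ • (Matrix.fromRows A (-B) * Qhat * (Matrix.fromRows A (-B))ᵀ)).PosDef := by
  have hQt : Qhatᵀ = Qhat := by rw [hQhat, Matrix.diagonal_transpose]
  have hQQ : Qhat * Qhat = Qhat := by
    rw [hQhat, Matrix.diagonal_mul_diagonal]
    congr 1
    ext i
    split_ifs <;> simp
  have hmain := quadratic_form_pos A B hQt hQQ hnondeg hσ
  refine ⟨hmain, Matrix.PosDef.of_dotProduct_mulVec_pos ?_ fun x hx => ?_⟩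
  · rw [Matrix.IsHermitian, Matrix.conjTranspose_eq_transpose_of_trivial, Matrix.transpose_add,
      Matrix.transpose_smul, Matrix.transpose_mul, Matrix.transpose_mul,
      Matrix.transpose_transpose, hQt, Matrix.mul_assoc, Matrix.fromBlocks_transpose]
    simp only [Matrix.transpose_one, Matrix.transpose_zero]
  · obtain ⟨u, v, rfl⟩ : ∃ u v, x = Sum.elim u v :=
      ⟨x ∘ Sum.inl, x ∘ Sum.inr, (Sum.elim_comp_inl_inr x).symm⟩
    have huv : ¬(u = 0 ∧ v = 0) := by
      rintro ⟨rfl, rfl⟩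
      exact hx Sum.elim_zero_zero
    have hR : (Matrix.fromRows A (-B))ᵀ *ᵥ Sum.elim u v = Aᵀ *ᵥ u - Bᵀ *ᵥ v := by
      rw [Matrix.transpose_fromRows, Matrix.fromCols_mulVec_sumElim, Matrix.transpose_neg,
        Matrix.neg_mulVec, sub_eq_add_neg]
    have hsq : star (Sum.elim u v) ⬝ᵥ (Matrix.fromBlocks (1 : Matrix (Fin m) (Fin m) ℝ) 0 0
        (0 : Matrix (Fin s) (Fin s) ℝ) *ᵥ Sum.elim u v) = u ⬝ᵥ u := by
      simp [Matrix.fromBlocks_mulVec, dotProduct]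
    rw [Matrix.add_mulVec, dotProduct_add, hsq, Matrix.smul_mulVec, dotProduct_smul,
      star_trivial, ← Matrix.mulVec_mulVec, hR, ← Matrix.mulVec_mulVec,
      Matrix.dotProduct_mulVec, ← Matrix.mulVec_transpose, hR, dotProduct_comm (_ - _),
      smul_eq_mul, ← euclNorm_sq, ← dotp_eq_dotProduct]
    exact hmain u v huv
end

section
/- The subdifferential of the ℓ₁ norm on ℝⁿ is metrically subregular in the following growth sense: for any x ∈ ℝⁿ and any s ∈ ∂‖·‖₁(x), there exist a constant κ > 0 and ε > 0 such that for all x' ∈ ℝⁿ with ‖x' − x‖ < ε, one has ‖x'‖₁ ≥ ‖x‖₁ + ⟨s, x' − x⟩ + κ · dist(x', (∂‖·‖₁)⁻¹(s))², where (∂‖·‖₁)⁻¹(s) = {y ∈ ℝⁿ : s ∈ ∂‖·‖₁(y)} and dist(x', T) = inf_{y∈T}‖x' − y‖. -/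
open Matrix

lemma l1norm_sub_dotp {n : ℕ} (s x : Fin n → ℝ) :
    l1norm x - dotp s x = ∑ i, (|x i| - s i * x i) := by
  simp only [l1norm, dotp, Finset.sum_sub_distrib]

lemma dotp_sub {n : ℕ} (s x y : Fin n → ℝ) : dotp s (x - y) = dotp s x - dotp s y := by
  simp only [dotp, Pi.sub_apply, mul_sub, Finset.sum_sub_distrib]

lemma abs_apply_le_euclNorm {n : ℕ} (x : Fin n → ℝ) (i : Fin n) : |x i| ≤ euclNorm x :=
  Real.abs_le_sqrt
    (Finset.single_le_sum (f := fun j => x j ^ 2) (fun _ _ => sq_nonneg _) (Finset.mem_univ i))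

lemma distSet_nonneg {n : ℕ} (x : Fin n → ℝ) (S : Set (Fin n → ℝ)) : 0 ≤ distSet x S := by
  apply Real.sInf_nonneg
  rintro _ ⟨y, -, rfl⟩
  exact Real.sqrt_nonneg _

lemma distSet_sq_le {n : ℕ} (x y : Fin n → ℝ) {S : Set (Fin n → ℝ)} (hy : y ∈ S) :
    distSet x S ^ 2 ≤ ∑ i, (x i - y i) ^ 2 := by
  have hle : distSet x S ≤ euclNorm (x - y) := by
    refine csInf_le ⟨0, ?_⟩ ⟨y, hy, rfl⟩
    rintro _ ⟨z, -, rfl⟩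
    exact Real.sqrt_nonneg _
  have hsq : euclNorm (x - y) ^ 2 = ∑ i, (x i - y i) ^ 2 :=
    Real.sq_sqrt (Finset.sum_nonneg fun i _ => sq_nonneg _)
  exact hsq ▸ pow_le_pow_left₀ (distSet_nonneg x S) hle 2

/-- A subgradient of the ℓ₁ norm at `x` lies in the sup-norm unit ball and attains
`⟨s, x⟩ = ‖x‖₁`; conversely these two properties characterize subgradients. -/
lemma mem_subdiff_l1norm {n : ℕ} {s x : Fin n → ℝ} :
    s ∈ subdiff l1norm x ↔ (∀ i, |s i| ≤ 1) ∧ l1norm x = dotp s x := by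
  constructor
  · intro h
    have h0 := h 0
    have h2 := h (x + x)
    have hl0 : l1norm (0 : Fin n → ℝ) = 0 := by simp [l1norm]
    have hd0 : dotp s 0 = 0 := by simp [dotp]
    have hl2 : l1norm (x + x) = 2 * l1norm x := by
      simp only [l1norm, Pi.add_apply, ← two_mul, abs_mul, abs_two, Finset.mul_sum]
    rw [dotp_sub, hl0, hd0] at h0
    rw [add_sub_cancel_right, hl2] at h2
    have hx : l1norm x = dotp s x := by linarith
    refine ⟨fun i => ?_, hx⟩
    have key (c : ℝ) : s i * c ≤ |c| := by
      have hc := h (Pi.single i c)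
      have hl : l1norm (Pi.single i c) = |c| := by
        rw [l1norm, Finset.sum_eq_single i] <;> simp +contextual
      have hd : dotp s (Pi.single i c) = s i * c := by simp [dotp, Pi.single_apply]
      rw [dotp_sub, hl, hd] at hc
      linarith
    have h1 := key 1
    have h2 := key (-1)
    rw [abs_neg] at h2
    rw [abs_one] at h1 h2
    exact abs_le.2 ⟨by linarith, by linarith⟩
  · rintro ⟨hs, hx⟩ y
    have hy : 0 ≤ l1norm y - dotp s y := by
      rw [l1norm_sub_dotp]
      refine Finset.sum_nonneg fun i _ => sub_nonneg.2 ((le_abs_self _).trans ?_)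
      rw [abs_mul]
      exact mul_le_of_le_one_left (abs_nonneg _) (hs i)
    rw [dotp_sub]
    linarith

/-- Scalar growth estimate: on a bounded interval, the gap `|t| - a * t` is either zero or
controls a multiple of `t ^ 2`. -/
lemma exists_mul_sq_le_abs_sub_mul {a M : ℝ} (ha : |a| ≤ 1) (hM : 0 < M) :
    ∃ κ > 0, ∀ t : ℝ, |t| ≤ M → |t| ≠ a * t → κ * t ^ 2 ≤ |t| - a * t := by
  have aux : ∃ δ > 0, ∀ t : ℝ, |t| ≠ a * t → δ * |t| ≤ |t| - a * t := by
    obtain h | h := ha.lt_or_eq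
    · refine ⟨1 - |a|, by linarith, fun t _ => ?_⟩
      have := le_abs_self (a * t)
      rw [abs_mul] at this
      linarith
    · refine ⟨2, two_pos, fun t ht => ?_⟩
      have habs : |a * t| = |t| := by rw [abs_mul, h, one_mul]
      obtain h' | h' := abs_choice (a * t)
      · exact absurd (habs.symm.trans h') ht
      · linarith
  obtain ⟨δ, hδ, hgap⟩ := aux
  refine ⟨δ / M, div_pos hδ hM, fun t htM ht => le_trans ?_ (hgap t ht)⟩
  rw [div_mul_eq_mul_div, div_le_iff₀ hM, ← sq_abs t, mul_assoc, sq]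
  gcongr

/-- **Metric subregularity (growth form) of the subdifferential of the ℓ₁ norm**
(Proposition 4(b)): for any `x` and any `s ∈ ∂‖·‖₁(x)`, there are `κ > 0` and `ε > 0`
such that for all `x'` with `‖x' − x‖ < ε`,
`‖x'‖₁ ≥ ‖x‖₁ + ⟨s, x' − x⟩ + κ · dist(x', (∂‖·‖₁)⁻¹(s))²`. -/
theorem l1norm_subdiff_metrically_subregular
    {n : ℕ} (x : Fin n → ℝ) (s : Fin n → ℝ) (hs : s ∈ subdiff l1norm x) :
    ∃ κ > 0, ∃ ε > 0, ∀ x' : Fin n → ℝ, euclNorm (x' - x) < ε →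
      l1norm x' ≥ l1norm x + dotp s (x' - x)
        + κ * distSet x' {y | s ∈ subdiff l1norm y} ^ 2 := by
  obtain ⟨hs1, hx⟩ := mem_subdiff_l1norm.1 hs
  have hM : 0 < euclNorm x + 1 := add_pos_of_nonneg_of_pos (Real.sqrt_nonneg _) one_pos
  choose κ hκ hgrow using fun i => exists_mul_sq_le_abs_sub_mul (hs1 i) hM
  have hev : ∀ᶠ k in nhdsWithin (0 : ℝ) (Set.Ioi 0), 0 < k ∧ ∀ i, k ≤ κ i :=
    eventually_mem_nhdsWithin.and
      (Filter.eventually_all.2 fun i => Filter.mem_of_superset (Ioc_mem_nhdsGT (hκ i))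
        fun _ hk => hk.2)
  obtain ⟨k, hk, hkκ⟩ := hev.exists
  refine ⟨k, hk, 1, one_pos, fun x' hx' => ?_⟩
  classical
  let y : Fin n → ℝ := fun i => if |x' i| = s i * x' i then x' i else 0
  have hy : s ∈ subdiff l1norm y := by
    refine mem_subdiff_l1norm.2 ⟨hs1, Finset.sum_congr rfl fun i _ => ?_⟩
    by_cases h : |x' i| = s i * x' i
    · simp only [y, if_pos h]
      exact h
    · simp only [y, if_neg h, abs_zero, mul_zero]
  have hdist := distSet_sq_le x' y (S := {y | s ∈ subdiff l1norm y}) hy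
  have hcoord : k * ∑ i, (x' i - y i) ^ 2 ≤ l1norm x' - dotp s x' := by
    rw [l1norm_sub_dotp, Finset.mul_sum]
    refine Finset.sum_le_sum fun i _ => ?_
    by_cases h : |x' i| = s i * x' i
    · simp only [y, if_pos h, sub_self]
      linarith
    · simp only [y, if_neg h, sub_zero]
      have hb : |x' i| ≤ euclNorm x + 1 := by
        have h1 := abs_apply_le_euclNorm (x' - x) i
        have h2 := abs_apply_le_euclNorm x i
        have h3 := abs_sub_abs_le_abs_sub (x' i) (x i)
        rw [Pi.sub_apply] at h1
        linarith
      exact (mul_le_mul_of_nonneg_right (hkκ i) (sq_nonneg _)).trans (hgrow i _ hb h)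
  have hmul := mul_le_mul_of_nonneg_left hdist hk.le
  rw [dotp_sub]
  linarith
end
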